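/- Let N ∈ {4,5,6}, m ≥ 1, λ̄ > 0, and let (λ_n) → λ̄ and (u_n) be radial solutions of the Brezis–Nirenberg problem with m nodal zones for λ_n, with first zeros r_n, such that u_n(0) → ∞. Then: if N = 4, r_n²·log u_n(0) → 2/λ̄ and u_n'(r_n)·u_n(0)·r_n³ → −16; if N = 5, u_n(0)·r_n^{9/2} → 15^{3/4}·(24/(π λ̄))^{3/2} and u_n'(r_n)/r_n^{1/2} → −3^{1/4}·5^{3/4}·(π λ̄/8)^{3/2}; if N = 6, u_n(0)·r_n⁴ → 1152/λ̄ and u_n'(r_n)·r_n → −2λ̄. -/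

import Mathlib

open Real Set Filter Topology

/-- A radial solution of the Brezis–Nirenberg problem `-Δu = |u|^{4/(N-2)} u + λ u`
on the unit ball of `ℝ^N` with `m` nodal zones: a `C²` function `u` on `[0,1]`
(given together with its first and second derivatives `u'`, `u''`) satisfying the
radial ODE, `u'(0) = 0`, `u(1) = 0`, `u(0) > 0`, with exactly `m - 1` zeros in `(0,1)`. -/
structure BNSol (N : ℕ) (lam : ℝ) (m : ℕ) (u u' u'' : ℝ → ℝ) : Prop where
  deriv_fst : ∀ r ∈ Set.Icc (0:ℝ) 1, HasDerivWithinAt u (u' r) (Set.Icc (0:ℝ) 1) r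
  deriv_snd : ∀ r ∈ Set.Icc (0:ℝ) 1, HasDerivWithinAt u' (u'' r) (Set.Icc (0:ℝ) 1) r
  cont_snd : ContinuousOn u'' (Set.Icc (0:ℝ) 1)
  ode : ∀ r ∈ Set.Ioo (0:ℝ) 1,
    u'' r + (((N:ℝ) - 1) / r) * u' r + |u r| ^ ((4:ℝ) / ((N:ℝ) - 2)) * u r + lam * u r = 0
  bc_deriv_zero : u' 0 = 0
  bc_one : u 1 = 0
  pos_zero : 0 < u 0
  nodal : {r : ℝ | r ∈ Set.Ioo (0:ℝ) 1 ∧ u r = 0}.ncard = m - 1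

/-- `ρ` is the first zero of `u` in `(0,1]`. -/
def IsFirstZero (u : ℝ → ℝ) (ρ : ℝ) : Prop :=
  ρ ∈ Set.Ioc (0:ℝ) 1 ∧ u ρ = 0 ∧ ∀ s ∈ Set.Ioo (0:ℝ) ρ, u s ≠ 0

namespace BN

lemma mono_aux {f f' : ℝ → ℝ} {a b : ℝ} (hab : a ≤ b) (hc : ContinuousOn f (Icc a b))
    (hd : ∀ x ∈ Ioo a b, HasDerivAt f (f' x) x) (h : ∀ x ∈ Ioo a b, 0 ≤ f' x) : f a ≤ f b := by
  have : MonotoneOn f (Icc a b) := by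
    apply monotoneOn_of_deriv_nonneg (convex_Icc a b) hc
    · intro x hx
      rw [interior_Icc] at hx
      exact (hd x hx).differentiableAt.differentiableWithinAt
    · intro x hx
      rw [interior_Icc] at hx
      rw [(hd x hx).deriv]
      exact h x hx
  exact this (left_mem_Icc.2 hab) (right_mem_Icc.2 hab) hab

structure Sc (j : ℕ) (k ε T : ℝ) (v v' : ℝ → ℝ) : Prop where
  hj : (j : ℝ) = 2 * k
  hk : 1 ≤ k
  hε : 0 < ε
  hT : 0 < T
  cv : ContinuousOn v (Icc 0 T)
  cv' : ContinuousOn v' (Icc 0 T)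
  dv : ∀ t ∈ Ioo 0 T, HasDerivAt v (v' t) t
  dv' : ∀ t ∈ Ioo 0 T, HasDerivAt v' (-((2 * k + 1) / t * v' t) - (v t) ^ (1 + 2 / k) - ε * v t) t
  v0 : v 0 = 1
  vT : v T = 0
  vpos : ∀ t ∈ Ioo 0 T, 0 < v t

variable {j : ℕ} {k ε T : ℝ} {v v' : ℝ → ℝ}

noncomputable def W (k t : ℝ) : ℝ := 1 + t ^ 2 / (4 * k * (k + 1))

lemma W_pos (hk : 1 ≤ k) (t : ℝ) : 0 < W k t := by
  unfold W
  have : 0 < 4 * k * (k + 1) := by nlinarith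
  positivity

lemma W_ge (hk : 1 ≤ k) (t : ℝ) : 1 ≤ W k t := by
  unfold W
  have : 0 < 4 * k * (k + 1) := by nlinarith
  have : 0 ≤ t ^ 2 / (4 * k * (k + 1)) := by positivity
  linarith

lemma W_deriv (hk : 1 ≤ k) (t : ℝ) : HasDerivAt (W k) (t / (2 * k * (k + 1))) t := by
  have h := ((hasDerivAt_pow 2 t).div_const (4 * k * (k + 1))).const_add 1
  have hk0 : k ≠ 0 := by linarith
  have hk1 : k + 1 ≠ 0 := by linarith
  refine h.congr_deriv ?_
  field_simp
  norm_num
  ring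

lemma W_cont (k : ℝ) : Continuous (W k) := by
  unfold W
  fun_prop

lemma W_rpow_cont (hk : 1 ≤ k) (a : ℝ) : Continuous (fun t => W k t ^ a) :=
  (W_cont k).rpow_const (fun t => Or.inl (W_pos hk t).ne')

lemma W_rpow_deriv (hk : 1 ≤ k) (a t : ℝ) :
    HasDerivAt (fun t => W k t ^ a) (t / (2 * k * (k + 1)) * a * W k t ^ (a - 1)) t :=
  (W_deriv hk t).rpow_const (Or.inl (W_pos hk t).ne')

namespace Sc

lemma vnn (S : Sc j k ε T v v') {t : ℝ} (ht : t ∈ Icc 0 T) : 0 ≤ v t := by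
  rcases eq_or_lt_of_le ht.1 with h | h
  · rw [← h, S.v0]; norm_num
  rcases eq_or_lt_of_le ht.2 with h' | h'
  · rw [h', S.vT]
  exact (S.vpos t ⟨h, h'⟩).le

lemma vpos' (S : Sc j k ε T v v') {t : ℝ} (ht : t ∈ Ico 0 T) : 0 < v t := by
  rcases eq_or_lt_of_le ht.1 with h | h
  · rw [← h, S.v0]; norm_num
  exact (S.vpos t ⟨h, ht.2⟩)

lemma dE (S : Sc j k ε T v v') {t : ℝ} (ht : t ∈ Ioo 0 T) :
    HasDerivAt (fun t => -(t ^ (j + 1) * v' t)) (t ^ (j + 1) * ((v t) ^ (1 + 2 / k) + ε * v t)) t := by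
  have h := ((hasDerivAt_pow (j + 1) t).mul (S.dv' t ht)).neg
  have ht0 : t ≠ 0 := ht.1.ne'
  refine h.congr_deriv ?_
  push_cast
  rw [S.hj]
  field_simp
  ring

lemma cE (S : Sc j k ε T v v') : ContinuousOn (fun t => -(t ^ (j + 1) * v' t)) (Icc 0 T) :=
  ((continuous_pow _).continuousOn.mul S.cv').neg

lemma E_mono (S : Sc j k ε T v v') {s t : ℝ} (hs : 0 ≤ s) (hst : s ≤ t) (ht : t ≤ T) :
    -(s ^ (j + 1) * v' s) ≤ -(t ^ (j + 1) * v' t) := by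
  refine mono_aux (f := fun t => -(t ^ (j + 1) * v' t)) hst
    (S.cE.mono (Icc_subset_Icc hs ht)) (fun x hx => S.dE ⟨hs.trans_lt hx.1, hx.2.trans_le ht⟩) ?_
  intro x hx
  have hx' : x ∈ Ioo 0 T := ⟨hs.trans_lt hx.1, hx.2.trans_le ht⟩
  have := S.vpos x hx'
  have := hx'.1
  have := S.hε
  positivity

lemma v'_nonpos (S : Sc j k ε T v v') {t : ℝ} (h0 : 0 < t) (ht : t ≤ T) : v' t ≤ 0 := by
  have := S.E_mono le_rfl h0.le ht
  simp only [ne_eq, Nat.add_eq_zero_iff, one_ne_zero, and_false, not_false_eq_true, zero_pow,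
    zero_mul, neg_zero] at this
  have hp : 0 < t ^ (j + 1) := by positivity
  by_contra hc
  push Not at hc
  have := mul_pos hp hc
  linarith

lemma v_anti (S : Sc j k ε T v v') {s t : ℝ} (hs : 0 ≤ s) (hst : s ≤ t) (ht : t ≤ T) : v t ≤ v s := by
  have := mono_aux (f := fun t => - v t) hst
    ((S.cv.mono (Icc_subset_Icc hs ht)).neg)
    (fun x hx => (S.dv x ⟨hs.trans_lt hx.1, hx.2.trans_le ht⟩).neg)
    (fun x hx => by
      have := S.v'_nonpos (hs.trans_lt hx.1) (hx.2.trans_le ht).le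
      linarith)
  have h : -v s ≤ -v t := this
  linarith

lemma k0 (S : Sc j k ε T v v') : 0 < k := by linarith [S.hk]

lemma E_lower (S : Sc j k ε T v v') {t : ℝ} (h0 : 0 ≤ t) (ht : t < T) :
    t ^ (j + 2) / (2 * k + 2) * ((v t) ^ (1 + 2 / k) + ε * v t) ≤ -(t ^ (j + 1) * v' t) := by
  have hk := S.k0
  have hN : (2 * k + 2) ≠ 0 := by linarith
  have hp : (1 + 2 / k) - 1 = 2 / k := by ring
  have key := mono_aux
    (f := fun t => -(t ^ (j + 1) * v' t) - t ^ (j + 2) / (2 * k + 2) * ((v t) ^ (1 + 2 / k) + ε * v t))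
    (f' := fun t => - (t ^ (j + 2) / (2 * k + 2) * (v' t * (1 + 2 / k) * (v t) ^ (2 / k) + ε * v' t)))
    h0 ?_ ?_ ?_
  · simp at key
    linarith
  · have c1 := S.cE.mono (Icc_subset_Icc le_rfl ht.le)
    have c2 := S.cv.mono (Icc_subset_Icc le_rfl ht.le)
    refine c1.sub (((continuous_pow _).continuousOn.div_const _).mul ((c2.rpow_const ?_).add
      (c2.const_smul ε)))
    intro x hx
    right
    positivity
  · intro x hx
    have hx' : x ∈ Ioo 0 T := ⟨hx.1, hx.2.trans ht⟩
    have d1 := (S.dv x hx').rpow_const (p := 1 + 2 / k) (Or.inl (S.vpos x hx').ne')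
    have d2 := (((hasDerivAt_pow (j + 2) x).div_const (2 * k + 2)).mul
      (d1.add ((S.dv x hx').const_mul ε)))
    refine ((S.dE hx').sub d2).congr_deriv ?_
    rw [hp]
    push_cast
    rw [S.hj]
    simp only [Pi.add_apply]
    field_simp
    ring
  · intro x hx
    have hx' : x ∈ Ioo 0 T := ⟨hx.1, hx.2.trans ht⟩
    have h1 := S.vpos x hx'
    have h2 := S.v'_nonpos hx.1 hx'.2.le
    have h3 := S.hε
    have h4 := hx.1
    have : 0 ≤ x ^ (j + 2) / (2 * k + 2) * ((-v' x) * (1 + 2 / k) * (v x) ^ (2 / k) + ε * (-v' x)) := by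
      have : 0 ≤ - v' x := by linarith
      positivity
    linarith

noncomputable def P (j : ℕ) (k ε : ℝ) (v v' : ℝ → ℝ) (t : ℝ) : ℝ :=
  t ^ (j + 2) * (v' t ^ 2 / 2 + k / (2 * k + 2) * (v t) ^ (2 + 2 / k) + ε * v t ^ 2 / 2)
    + k * t ^ (j + 1) * (v t * v' t)

lemma dP (S : Sc j k ε T v v') {t : ℝ} (ht : t ∈ Ioo 0 T) :
    HasDerivAt (P j k ε v v') (ε * (t ^ (j + 1) * v t ^ 2)) t := by
  have hk := S.k0
  have ht0 := ht.1.ne'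
  have hv := S.vpos t ht
  have dv := S.dv t ht
  have dv' := S.dv' t ht
  have d1 := dv.rpow_const (p := 2 + 2 / k) (Or.inl hv.ne')
  have e1 : 2 + 2 / k - 1 = 1 + 2 / k := by ring
  have e2 : v t ^ (2 + 2 / k) = v t * v t ^ (1 + 2 / k) := by
    rw [← e1, ← rpow_one_add' hv.le]
    · congr 1; ring
    · rw [show 1 + (2 + 2 / k - 1) = 2 + 2 / k by ring]; positivity
  have d := ((hasDerivAt_pow (j + 2) t).mul
    ((((dv'.pow 2).div_const 2).add (d1.const_mul (k / (2 * k + 2)))).add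
      (((dv.pow 2).const_mul ε).div_const 2))).add
    (((hasDerivAt_pow (j + 1) t).const_mul k).mul (dv.mul dv'))
  refine (d.congr_deriv ?_)
  have : j + 2 - 1 = j + 1 := by omega
  simp only [Pi.add_apply, Pi.mul_apply, Pi.pow_apply, this, Nat.add_sub_cancel]
  rw [e1, e2]
  push_cast
  rw [S.hj]
  generalize v t ^ (1 + 2 / k) = y
  have : (2 * k + 2) ≠ 0 := by linarith
  field_simp
  ring

lemma cP (S : Sc j k ε T v v') : ContinuousOn (P j k ε v v') (Icc 0 T) := by
  have hk := S.k0
  have c1 := S.cv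
  have c2 := S.cv'
  have c3 : ContinuousOn (fun t => v t ^ (2 + 2 / k)) (Icc 0 T) :=
    c1.rpow_const (fun x _ => Or.inr (by positivity))
  unfold P
  fun_prop

lemma P_zero : P j k ε v v' 0 = 0 := by simp [P]

lemma P_T (S : Sc j k ε T v v') : P j k ε v v' T = T ^ (j + 2) * (v' T ^ 2 / 2) := by
  have hk := S.k0
  have : (2 + 2 / k) ≠ 0 := by positivity
  simp [P, S.vT, zero_rpow this]

lemma P_lower (S : Sc j k ε T v v') {t : ℝ} (h0 : 0 ≤ t) (ht : t ≤ T) :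
    ε * (t ^ (j + 2) * v t ^ 2) / (2 * k + 2) ≤ P j k ε v v' t := by
  have hk := S.k0
  have key := mono_aux
    (f := fun t => P j k ε v v' t - ε * (t ^ (j + 2) * v t ^ 2) / (2 * k + 2))
    (f' := fun t => - (ε * (t ^ (j + 2) * (2 * v t * v' t)) / (2 * k + 2)))
    h0 ?_ ?_ ?_
  · simp [P_zero] at key
    linarith
  · have c1 := S.cP.mono (Icc_subset_Icc le_rfl ht)
    have c2 := S.cv.mono (Icc_subset_Icc le_rfl ht)
    fun_prop
  · intro x hx
    have hx' : x ∈ Ioo 0 T := ⟨hx.1, hx.2.trans_le ht⟩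
    have d2 := (((hasDerivAt_pow (j + 2) x).mul ((S.dv x hx').pow 2)).const_mul ε).div_const
      (2 * k + 2)
    refine ((S.dP hx').sub d2).congr_deriv ?_
    push_cast
    rw [S.hj]
    simp only [Pi.pow_apply]
    have : (2 * k + 2) ≠ 0 := by linarith
    field_simp
    ring
  · intro x hx
    have hx' : x ∈ Ioo 0 T := ⟨hx.1, hx.2.trans_le ht⟩
    have h1 := S.vpos x hx'
    have h2 := S.v'_nonpos hx.1 hx'.2.le
    have h3 := S.hε
    have h4 := hx.1
    have : 0 ≤ (ε * (x ^ (j + 2) * (2 * v x * (- v' x))) / (2 * k + 2)) := by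
      have : 0 ≤ - v' x := by linarith
      positivity
    linarith [this, show ε * (x ^ (j + 2) * (2 * v x * (- v' x))) / (2 * k + 2) =
      -(ε * (x ^ (j + 2) * (2 * v x * v' x)) / (2 * k + 2)) by ring]

lemma Q_deriv (S : Sc j k ε T v v') {t : ℝ} (ht : t ∈ Ioo 0 T) :
    HasDerivAt (fun t => -(v' t * v t ^ (-(1 + 1 / k)) / t))
      (2 * (1 + 1 / k) * v t ^ (-(1 + 1 / k)) / (t ^ (j + 3) * v t) *
        (P j k ε v v' t - ε * (t ^ (j + 2) * v t ^ 2) / (2 * k + 2))) t := by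
  have hk := S.k0
  have ht0 := ht.1.ne'
  have hv := S.vpos t ht
  have dv := S.dv t ht
  have dv' := S.dv' t ht
  have d1 := dv.rpow_const (p := -(1 + 1 / k)) (Or.inl hv.ne')
  have e1 : v t ^ (-(1 + 1 / k) - 1) = v t ^ (-(1 + 1 / k)) / v t := by
    rw [rpow_sub_one hv.ne']
  have e2 : v t ^ (2 + 2 / k) = v t * v t ^ (1 + 2 / k) := by
    rw [← rpow_one_add' hv.le]
    · congr 1; ring
    · rw [show 1 + (1 + 2 / k) = 2 + 2 / k by ring]; positivity
  have d := ((dv'.mul d1).div (hasDerivAt_id t) ht0).neg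
  refine d.congr_deriv ?_
  simp only [Pi.mul_apply, id, P]
  rw [e1, e2]
  generalize v t ^ (1 + 2 / k) = y
  generalize v t ^ (-(1 + 1 / k)) = z
  have : (2 * k + 2) ≠ 0 := by linarith
  have : k + 1 ≠ 0 := by linarith
  have := hv.ne'
  field_simp
  ring

lemma Q_lower (S : Sc j k ε T v v') {t : ℝ} (ht : t ∈ Ioo 0 T) :
    1 / (2 * k + 2) ≤ -(v' t * v t ^ (-(1 + 1 / k)) / t) := by
  have hk := S.k0
  have step : ∀ s ∈ Ioo 0 t, v s ^ (1 / k) / (2 * k + 2) ≤ -(v' t * v t ^ (-(1 + 1 / k)) / t) := by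
    intro s hs
    have hsT : s ∈ Ioo 0 T := ⟨hs.1, hs.2.trans ht.2⟩
    have h1 : -(v' s * v s ^ (-(1 + 1 / k)) / s) ≤ -(v' t * v t ^ (-(1 + 1 / k)) / t) := by
      refine mono_aux (f := fun t => -(v' t * v t ^ (-(1 + 1 / k)) / t)) hs.2.le ?_
        (fun x hx => S.Q_deriv ⟨hs.1.trans hx.1, hx.2.trans ht.2⟩) ?_
      · intro x hx
        exact (S.Q_deriv ⟨hs.1.trans_le hx.1, hx.2.trans_lt ht.2⟩).continuousAt.continuousWithinAt
      · intro x hx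
        have hx' : x ∈ Ioo 0 T := ⟨hs.1.trans hx.1, hx.2.trans ht.2⟩
        have := S.P_lower hx'.1.le hx'.2.le
        have h4 := S.vpos x hx'
        have h5 := hx'.1
        have : 0 ≤ P j k ε v v' x - ε * (x ^ (j + 2) * v x ^ 2) / (2 * k + 2) := by linarith
        positivity
    refine le_trans ?_ h1
    have h2 := S.E_lower hs.1.le hsT.2
    have hv := S.vpos s hsT
    have e : v s ^ (1 / k) = v s ^ (1 + 2 / k) * v s ^ (-(1 + 1 / k)) := by
      rw [← rpow_add hv]; congr 1; ring
    rw [e]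
    have h3 : s / (2 * k + 2) * v s ^ (1 + 2 / k) ≤ - v' s := by
      have h5 : 0 < s ^ (j + 1) := by have := hs.1; positivity
      have h6 : 0 ≤ s ^ (j + 2) / (2 * k + 2) * (ε * v s) := by
        have := hs.1
        have := S.hε
        positivity
      have : s ^ (j + 1) * (s / (2 * k + 2) * v s ^ (1 + 2 / k)) ≤ s ^ (j + 1) * (- v' s) := by
        calc _ = s ^ (j + 2) / (2 * k + 2) * v s ^ (1 + 2 / k) := by ring
          _ ≤ _ := by linarith
      exact le_of_mul_le_mul_left this h5
    have hz : 0 < v s ^ (-(1 + 1 / k)) := by positivity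
    have hs0 := hs.1
    rw [show -(v' s * v s ^ (-(1 + 1 / k)) / s) = (- v' s) * v s ^ (-(1 + 1 / k)) / s by ring,
      le_div_iff₀ hs0]
    calc _ = (s / (2 * k + 2) * v s ^ (1 + 2 / k)) * v s ^ (-(1 + 1 / k)) := by ring
      _ ≤ _ := by gcongr
  have lim : Tendsto (fun s => v s ^ (1 / k) / (2 * k + 2)) (𝓝[>] 0) (𝓝 (1 / (2 * k + 2))) := by
    have c : ContinuousWithinAt v (Ioo 0 T) 0 :=
      (S.cv 0 ⟨le_rfl, S.hT.le⟩).mono Ioo_subset_Icc_self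
    have c' : Tendsto v (𝓝[>] 0) (𝓝 1) := by
      have := c.tendsto
      rwa [S.v0, nhdsWithin_Ioo_eq_nhdsGT S.hT] at this
    have := (c'.rpow_const (p := 1 / k) (Or.inl one_ne_zero)).div_const (2 * k + 2)
    simpa using this
  refine le_of_tendsto lim ?_
  filter_upwards [Ioo_mem_nhdsGT ht.1] with s hs using step s hs

lemma v'_upper (S : Sc j k ε T v v') {t : ℝ} (ht : t ∈ Ioo 0 T) :
    t * v t ^ (1 + 1 / k) / (2 * k + 2) ≤ - v' t := by
  have h := S.Q_lower ht
  have hv := S.vpos t ht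
  have hk := S.k0
  rw [rpow_neg hv.le] at h
  have hz : 0 < v t ^ (1 + 1 / k) := by positivity
  have ht0 := ht.1
  have e : -(v' t * (v t ^ (1 + 1 / k))⁻¹ / t) = (- v' t) / (t * v t ^ (1 + 1 / k)) := by
    field_simp
  rw [e, le_div_iff₀ (by positivity)] at h
  linarith [show 1 / (2 * k + 2) * (t * v t ^ (1 + 1 / k)) = t * v t ^ (1 + 1 / k) / (2 * k + 2) by ring]

lemma v_le (S : Sc j k ε T v v') {t : ℝ} (h0 : 0 ≤ t) (ht : t ≤ T) : v t ≤ W k t ^ (-k) := by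
  have hk := S.k0
  rcases eq_or_lt_of_le ht with h | h
  · rw [h, S.vT]; exact (rpow_pos_of_pos (W_pos S.hk _) _).le
  have hv : 0 < v t := S.vpos' ⟨h0, h⟩
  have key : W k t ≤ v t ^ (-(1 / k)) := by
    have := mono_aux (f := fun t => v t ^ (-(1 / k)) - W k t)
      (f' := fun t => v' t * (-(1 / k)) * v t ^ (-(1 / k) - 1) - t / (2 * k * (k + 1))) h0 ?_ ?_ ?_
    · simp only [S.v0, W] at this
      simp only [W]
      simp at this
      simp
      linarith
    · have c := S.cv.mono (Icc_subset_Icc le_rfl h.le)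
      refine (c.rpow_const ?_).sub (W_cont k).continuousOn
      intro x hx
      left
      exact (S.vpos' ⟨hx.1, hx.2.trans_lt h⟩).ne'
    · intro x hx
      have hx' : x ∈ Ioo 0 T := ⟨hx.1, hx.2.trans h⟩
      exact ((S.dv x hx').rpow_const (Or.inl (S.vpos x hx').ne')).sub (W_deriv S.hk x)
    · intro x hx
      have hx' : x ∈ Ioo 0 T := ⟨hx.1, hx.2.trans h⟩
      have h1 := S.Q_lower hx'
      rw [show -(1 + 1 / k) = -(1 / k) - 1 by ring] at h1
      generalize v x ^ (-(1 / k) - 1) = z at h1 ⊢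
      have hx0 := hx.1
      have e : -(v' x * z / x) = (- v' x * z) / x := by ring
      rw [e, le_div_iff₀ hx0] at h1
      have h2 : 1 / k * (1 / (2 * k + 2) * x) ≤ 1 / k * (-v' x * z) := by gcongr
      have e2 : 1 / k * (1 / (2 * k + 2) * x) = x / (2 * k * (k + 1)) := by field_simp
      rw [e2] at h2
      linarith
  have h3 : v t = (v t ^ (-(1 / k))) ^ (-k) := by
    rw [← rpow_mul hv.le]
    have : -(1 / k) * -k = 1 := by field_simp
    rw [this, rpow_one]
  rw [h3]
  exact rpow_le_rpow_of_nonpos (W_pos S.hk _) key (by linarith)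

end Sc
end BN
namespace BN
variable {j : ℕ} {k ε T : ℝ} {v v' : ℝ → ℝ}

noncomputable def AA (j : ℕ) (k t : ℝ) : ℝ := t ^ (j + 2) / (2 * k + 2) * W k t ^ (-k - 1)

lemma AA_deriv (hk : 1 ≤ k) (hj : (j : ℝ) = 2 * k) (t : ℝ) :
    HasDerivAt (AA j k) (t ^ (j + 1) * W k t ^ (-k - 2)) t := by
  have d := ((hasDerivAt_pow (j + 2) t).div_const (2 * k + 2)).mul (W_rpow_deriv hk (-k - 1) t)
  refine d.congr_deriv ?_
  have hW := W_pos hk t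
  have e : W k t ^ (-k - 1) = W k t * W k t ^ (-k - 2) := by
    rw [← rpow_one_add' hW.le]
    · congr 1; ring
    · intro h; linarith
  rw [show -k - 1 - 1 = -k - 2 by ring, e]
  generalize W k t ^ (-k - 2) = y
  unfold W
  push_cast
  rw [hj]
  have : (2 * k + 2) ≠ 0 := by linarith
  have : k + 1 ≠ 0 := by linarith
  have : k ≠ 0 := by linarith
  field_simp
  ring

lemma AA_zero : AA j k 0 = 0 := by simp [AA]

lemma sq_div_W_le (hk : 1 ≤ k) (t : ℝ) : t ^ 2 / W k t ≤ 4 * k * (k + 1) := by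
  have hc : 0 < 4 * k * (k + 1) := by nlinarith
  rw [div_le_iff₀ (W_pos hk t)]
  unfold W
  have : 4 * k * (k + 1) * (1 + t ^ 2 / (4 * k * (k + 1))) = 4 * k * (k + 1) + t ^ 2 := by
    field_simp
  linarith

lemma pow_eq_rpow {t : ℝ} (ht : 0 ≤ t) {n : ℕ} {a : ℝ} (h : (n : ℝ) = 2 * a) :
    t ^ n = (t ^ 2) ^ a := by
  rw [← rpow_natCast, h, rpow_mul ht]
  norm_num

lemma AA_eq (hk : 1 ≤ k) (hj : (j : ℝ) = 2 * k) {t : ℝ} (ht : 0 ≤ t) :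
    AA j k t = (t ^ 2 / W k t) ^ (k + 1) / (2 * k + 2) := by
  unfold AA
  rw [pow_eq_rpow ht (n := j + 2) (a := k + 1) (by push_cast; rw [hj]; ring),
    div_rpow (by positivity) (W_pos hk t).le, show -k - 1 = -(k + 1) by ring,
    rpow_neg (W_pos hk t).le]
  field_simp

lemma AA_le (hk : 1 ≤ k) (hj : (j : ℝ) = 2 * k) {t : ℝ} (ht : 0 ≤ t) :
    AA j k t ≤ (4 * k * (k + 1)) ^ (k + 1) / (2 * k + 2) := by
  rw [AA_eq hk hj ht]
  have := sq_div_W_le hk t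
  have := W_pos hk t
  gcongr

lemma W_tendsto (hk : 1 ≤ k) : Tendsto (W k) atTop atTop := by
  have hc : 0 < 4 * k * (k + 1) := by nlinarith
  unfold W
  exact tendsto_atTop_add_const_left _ _
    ((tendsto_pow_atTop (two_ne_zero)).atTop_div_const hc)

lemma AA_tendsto (hk : 1 ≤ k) (hj : (j : ℝ) = 2 * k) :
    Tendsto (AA j k) atTop (𝓝 ((4 * k * (k + 1)) ^ (k + 1) / (2 * k + 2))) := by
  have hc : 0 < 4 * k * (k + 1) := by nlinarith
  have h1 : Tendsto (fun t => t ^ 2 / W k t) atTop (𝓝 (4 * k * (k + 1))) := by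
    have h2 : Tendsto (fun t => 4 * k * (k + 1) * (1 - (W k t)⁻¹)) atTop
        (𝓝 (4 * k * (k + 1) * (1 - 0))) :=
      ((tendsto_inv_atTop_zero.comp (W_tendsto hk)).const_sub 1).const_mul _
    simp only [sub_zero, mul_one] at h2
    refine h2.congr (fun t => ?_)
    have hW := W_pos hk t
    field_simp
    unfold W
    field_simp
    ring
  have h3 := (h1.rpow_const (p := k + 1) (Or.inl hc.ne')).div_const (2 * k + 2)
  refine h3.congr' ?_
  filter_upwards [eventually_ge_atTop 0] with t ht
  rw [AA_eq hk hj ht]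

namespace Sc

lemma E_upper (S : Sc j k ε T v v') {H h : ℝ → ℝ} (hc : Continuous H)
    (hd : ∀ x, 0 < x → HasDerivAt H (h x) x)
    (hh : ∀ x, 0 < x → x ^ (j + 1) * W k x ^ (-k) ≤ h x) (H0 : H 0 = 0)
    {t : ℝ} (h0 : 0 ≤ t) (ht : t ≤ T) :
    -(t ^ (j + 1) * v' t) ≤ AA j k t + ε * H t := by
  have hk := S.k0
  have key := mono_aux (f := fun t => AA j k t + ε * H t - -(t ^ (j + 1) * v' t))
    (f' := fun t => t ^ (j + 1) * W k t ^ (-k - 2) + ε * h t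
      - t ^ (j + 1) * ((v t) ^ (1 + 2 / k) + ε * v t)) h0 ?_ ?_ ?_
  · simp [AA_zero, H0] at key
    linarith
  · have c1 := S.cE.mono (Icc_subset_Icc le_rfl ht)
    have c2 : Continuous (AA j k) :=
      continuous_iff_continuousAt.2 fun t => (AA_deriv S.hk S.hj t).continuousAt
    exact (c2.add (hc.const_smul ε)).continuousOn.sub c1
  · intro x hx
    have hx' : x ∈ Ioo 0 T := ⟨hx.1, hx.2.trans_le ht⟩
    exact ((AA_deriv S.hk S.hj x).add ((hd x hx.1).const_mul ε)).sub (S.dE hx')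
  · intro x hx
    have hx' : x ∈ Ioo 0 T := ⟨hx.1, hx.2.trans_le ht⟩
    have hv := S.v_le hx'.1.le hx'.2.le
    have hvp := S.vpos x hx'
    have hW := W_pos S.hk x
    have hx0 := hx.1
    have hε := S.hε
    have h1 : v x ^ (1 + 2 / k) ≤ W k x ^ (-k - 2) := by
      calc _ ≤ (W k x ^ (-k)) ^ (1 + 2 / k) := by gcongr
        _ = _ := by
          rw [← rpow_mul hW.le]; congr 1; field_simp
          ring
    have h2 := hh x hx0
    have h3 : x ^ (j + 1) * v x ≤ h x := le_trans (by gcongr) h2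
    have h4 : x ^ (j + 1) * v x ^ (1 + 2 / k) ≤ x ^ (j + 1) * W k x ^ (-k - 2) := by gcongr
    have h5 : ε * (x ^ (j + 1) * v x) ≤ ε * h x := by gcongr
    linarith [show x ^ (j + 1) * ((v x) ^ (1 + 2 / k) + ε * v x) =
      x ^ (j + 1) * v x ^ (1 + 2 / k) + ε * (x ^ (j + 1) * v x) by ring]

lemma v_ge (S : Sc j k ε T v v') {H h L l : ℝ → ℝ} (hc : Continuous H)
    (hd : ∀ x, 0 < x → HasDerivAt H (h x) x)
    (hh : ∀ x, 0 < x → x ^ (j + 1) * W k x ^ (-k) ≤ h x) (H0 : H 0 = 0)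
    (hLc : Continuous L) (hLd : ∀ x, 0 < x → HasDerivAt L (l x) x) (hL0 : L 0 = 0)
    (hHl : ∀ x, 0 < x → H x = x ^ (j + 1) * l x)
    {t : ℝ} (h0 : 0 ≤ t) (ht : t ≤ T) :
    W k t ^ (-k) - ε * L t ≤ v t := by
  have hk := S.k0
  have key := mono_aux (f := fun t => v t - (W k t ^ (-k) - ε * L t))
    (f' := fun t => v' t - (t / (2 * k * (k + 1)) * (-k) * W k t ^ (-k - 1) - ε * l t)) h0 ?_ ?_ ?_
  · simp [hL0, S.v0, W] at key
    simp only [W]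
    linarith
  · have c1 := S.cv.mono (Icc_subset_Icc le_rfl ht)
    exact c1.sub (((W_rpow_cont S.hk _).sub (hLc.const_smul ε)).continuousOn)
  · intro x hx
    have hx' : x ∈ Ioo 0 T := ⟨hx.1, hx.2.trans_le ht⟩
    exact (S.dv x hx').sub ((W_rpow_deriv S.hk _ _).sub ((hLd x hx.1).const_mul ε))
  · intro x hx
    have hx0 := hx.1
    have h1 := S.E_upper hc hd hh H0 hx0.le (hx.2.trans_le ht).le
    rw [hHl x hx0] at h1
    have hp : 0 < x ^ (j + 1) := by positivity
    unfold AA at h1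
    have h2 : x ^ (j + 1) * (- v' x) ≤
        x ^ (j + 1) * (x / (2 * k + 2) * W k x ^ (-k - 1) + ε * l x) := by
      calc _ = -(x ^ (j + 1) * v' x) := by ring
        _ ≤ _ := h1
        _ = _ := by ring
    have h3 := le_of_mul_le_mul_left h2 hp
    have e : x / (2 * k * (k + 1)) * (-k) * W k x ^ (-k - 1) = - (x / (2 * k + 2) * W k x ^ (-k - 1)) := by
      field_simp
    rw [e]
    linarith

lemma v_ge_quad (S : Sc j k ε T v v') {t : ℝ} (h0 : 0 ≤ t) (ht : t ≤ T) :
    W k t ^ (-k) - ε * (t ^ 2 / (2 * (2 * k + 2))) ≤ v t := by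
  have hk := S.k0
  refine S.v_ge (H := fun t => t ^ (j + 2) / (2 * k + 2)) (h := fun t => t ^ (j + 1))
    (L := fun t => t ^ 2 / (2 * (2 * k + 2))) (l := fun t => t / (2 * k + 2))
    (by fun_prop) ?_ ?_ (by simp) (by fun_prop) ?_ (by simp) ?_ h0 ht
  · intro x hx
    refine ((hasDerivAt_pow (j + 2) x).div_const (2 * k + 2)).congr_deriv ?_
    push_cast
    rw [S.hj]
    field_simp
  · intro x hx
    have : W k x ^ (-k) ≤ 1 := rpow_le_one_of_one_le_of_nonpos (W_ge S.hk x) (by linarith)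
    have hp : 0 < x ^ (j + 1) := by positivity
    nlinarith
  · intro x hx
    refine ((hasDerivAt_pow 2 x).div_const (2 * (2 * k + 2))).congr_deriv ?_
    field_simp
    norm_num
  · intro x hx
    ring

lemma E_upper_T (S : Sc j k ε T v v') :
    -(T ^ (j + 1) * v' T) ≤ (4 * k * (k + 1)) ^ (k + 1) / (2 * k + 2)
      + (4 * k * (k + 1)) ^ k / 2 * (ε * T ^ 2) := by
  have hk := S.k0
  have h := S.E_upper (H := fun t => (4 * k * (k + 1)) ^ k / 2 * t ^ 2)
    (h := fun t => (4 * k * (k + 1)) ^ k * t) (by fun_prop) ?_ ?_ (by simp) S.hT.le le_rfl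
  · have := AA_le S.hk S.hj S.hT.le
    linarith
  · intro x hx
    refine ((hasDerivAt_pow 2 x).const_mul ((4 * k * (k + 1)) ^ k / 2)).congr_deriv ?_
    push_cast
    ring
  · intro x hx
    have hW := W_pos S.hk x
    have e : x ^ (j + 1) * W k x ^ (-k) = (x ^ 2 / W k x) ^ k * x := by
      rw [pow_succ, pow_eq_rpow hx.le S.hj, div_rpow (by positivity) hW.le, rpow_neg hW.le]
      field_simp
    rw [e]
    have := sq_div_W_le S.hk x
    gcongr

lemma P_mono (S : Sc j k ε T v v') {s t : ℝ} (hs : 0 ≤ s) (hst : s ≤ t) (ht : t ≤ T) :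
    P j k ε v v' s ≤ P j k ε v v' t := by
  refine mono_aux hst
    (S.cP.mono (Icc_subset_Icc hs ht)) (fun x hx => S.dP ⟨hs.trans_lt hx.1, hx.2.trans_le ht⟩) ?_
  intro x hx
  have hx' : x ∈ Ioo 0 T := ⟨hs.trans_lt hx.1, hx.2.trans_le ht⟩
  have := hx'.1
  have := S.hε
  positivity

lemma P_ge (S : Sc j k ε T v v') {F f : ℝ → ℝ} {t : ℝ} (h0 : 0 ≤ t) (ht : t ≤ T)
    (hc : Continuous F) (hd : ∀ x ∈ Ioo 0 t, HasDerivAt F (f x) x)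
    (hf : ∀ x ∈ Ioo 0 t, f x ≤ x ^ (j + 1) * v x ^ 2) (F0 : F 0 = 0) :
    ε * F t ≤ P j k ε v v' T := by
  refine le_trans ?_ (S.P_mono h0 ht le_rfl)
  have key := mono_aux (f := fun t => P j k ε v v' t - ε * F t)
    (f' := fun t => ε * (t ^ (j + 1) * v t ^ 2) - ε * f t) h0 ?_ ?_ ?_
  · simp [P_zero, F0] at key
    linarith
  · exact (S.cP.mono (Icc_subset_Icc le_rfl ht)).sub (hc.const_smul ε).continuousOn
  · intro x hx
    exact (S.dP ⟨hx.1, hx.2.trans_le ht⟩).sub ((hd x hx).const_mul ε)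
  · intro x hx
    have := mul_le_mul_of_nonneg_left (hf x hx) S.hε.le
    linarith

lemma P_le (S : Sc j k ε T v v') {G : ℝ → ℝ}
    (hc : Continuous G) (hd : ∀ x, 0 < x → HasDerivAt G (x ^ (j + 1) * (W k x ^ (-k)) ^ 2) x)
    (G0 : G 0 = 0) :
    P j k ε v v' T ≤ ε * G T := by
  have key := mono_aux (f := fun t => ε * G t - P j k ε v v' t)
    (f' := fun t => ε * (t ^ (j + 1) * (W k t ^ (-k)) ^ 2) - ε * (t ^ (j + 1) * v t ^ 2)) S.hT.le ?_ ?_ ?_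
  · simp [P_zero, G0] at key
    linarith
  · exact (hc.const_smul ε).continuousOn.sub S.cP
  · intro x hx
    exact ((hd x hx.1).const_mul ε).sub (S.dP hx)
  · intro x hx
    have h1 := S.v_le hx.1.le hx.2.le
    have h2 := S.vpos x hx
    have h3 := hx.1
    have h4 := S.hε
    have : ε * (x ^ (j + 1) * v x ^ 2) ≤ ε * (x ^ (j + 1) * (W k x ^ (-k)) ^ 2) := by gcongr
    linarith

lemma sq_ge {b e w : ℝ} (hb : 0 ≤ b) (_hw : 0 ≤ w) (h : b - e ≤ w) : b ^ 2 - 2 * b * e ≤ w ^ 2 := by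
  rcases le_total (b - e) 0 with h1 | h1
  · nlinarith
  · nlinarith [mul_self_le_mul_self h1 h, sq_nonneg e]

lemma P_ge_quad (S : Sc j k ε T v v') {G : ℝ → ℝ}
    (hc : Continuous G) (hd : ∀ x, 0 < x → HasDerivAt G (x ^ (j + 1) * (W k x ^ (-k)) ^ 2) x)
    (G0 : G 0 = 0) {t : ℝ} (h0 : 0 ≤ t) (ht : t ≤ T) :
    ε * (G t - ε * t ^ (j + 4)) ≤ P j k ε v v' T := by
  have hk := S.k0
  refine S.P_ge (F := fun t => G t - ε * t ^ (j + 4))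
    (f := fun x => x ^ (j + 1) * (W k x ^ (-k)) ^ 2 - ε * (((j + 4 : ℕ) : ℝ) * x ^ (j + 3))) h0 ht
    (by fun_prop) ?_ ?_ (by simp [G0])
  · intro x hx
    exact (hd x hx.1).sub ((hasDerivAt_pow (j + 4) x).const_mul ε)
  · intro x hx
    have h1 := S.v_ge_quad hx.1.le (hx.2.trans_le ht).le
    have h2 := S.vpos x ⟨hx.1, hx.2.trans_le ht⟩
    have hb : 0 < W k x ^ (-k) := rpow_pos_of_pos (W_pos S.hk x) _
    have hb1 : W k x ^ (-k) ≤ 1 := rpow_le_one_of_one_le_of_nonpos (W_ge S.hk x) (by linarith)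
    have h3 := sq_ge hb.le h2.le h1
    have hx0 := hx.1
    have hε := S.hε
    have h4 : 2 * W k x ^ (-k) * (ε * (x ^ 2 / (2 * (2 * k + 2)))) ≤ ε * x ^ 2 := by
      have h5 : W k x ^ (-k) / (2 * k + 2) ≤ 1 := by
        rw [div_le_one (by linarith)]
        linarith
      calc _ = W k x ^ (-k) / (2 * k + 2) * (ε * x ^ 2) := by field_simp
        _ ≤ 1 * (ε * x ^ 2) := by gcongr
        _ = _ := one_mul _
    have hp : 0 < x ^ (j + 1) := by positivity
    have h6 : x ^ (j + 1) * ((W k x ^ (-k)) ^ 2 - ε * x ^ 2) ≤ x ^ (j + 1) * v x ^ 2 := by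
      apply mul_le_mul_of_nonneg_left _ hp.le
      linarith
    have h7 : ε * x ^ (j + 3) ≤ ε * (((j + 4 : ℕ) : ℝ) * x ^ (j + 3)) := by
      have : 0 < ε * x ^ (j + 3) := by positivity
      have h8 : (1 : ℝ) ≤ ((j + 4 : ℕ) : ℝ) := by
        norm_cast; omega
      nlinarith
    linarith [show x ^ (j + 1) * ((W k x ^ (-k)) ^ 2 - ε * x ^ 2) =
      x ^ (j + 1) * (W k x ^ (-k)) ^ 2 - ε * x ^ (j + 3) by ring]

lemma poh (S : Sc j k ε T v v') :
    (-(T ^ (j + 1) * v' T)) ^ 2 = 2 * T ^ j * P j k ε v v' T := by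
  rw [S.P_T]
  ring

lemma E_nonneg (S : Sc j k ε T v v') : 0 ≤ -(T ^ (j + 1) * v' T) := by
  have := S.E_mono le_rfl S.hT.le le_rfl
  simpa using this

end Sc
end BN
namespace BN
open Sc

variable {j : ℕ} {k : ℝ} {ε T : ℕ → ℝ} {v v' : ℕ → ℝ → ℝ}

lemma T_large (hk : 1 ≤ k) (hS : ∀ᶠ n in atTop, Sc j k (ε n) (T n) (v n) (v' n))
    (hε : Tendsto ε atTop (𝓝 0)) : Tendsto T atTop atTop := by
  rw [tendsto_atTop]
  intro T0
  set T1 := max T0 1 with hT1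
  have h1 : 0 < T1 := lt_of_lt_of_le one_pos (le_max_right _ _)
  have hb : 0 < W k T1 ^ (-k) := rpow_pos_of_pos (W_pos hk _) _
  have lim : Tendsto (fun n => ε n * (T1 ^ 2 / (2 * (2 * k + 2)))) atTop (𝓝 0) := by
    simpa using hε.mul_const (T1 ^ 2 / (2 * (2 * k + 2)))
  filter_upwards [hS, lim.eventually_lt_const hb] with n S hn
  by_contra hc
  push Not at hc
  have hc1 : T n < T1 := lt_of_lt_of_le hc (le_max_left _ _)
  have h2 := S.v_ge_quad S.hT.le le_rfl
  rw [S.vT] at h2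
  have h3 : W k T1 ^ (-k) ≤ W k (T n) ^ (-k) := by
    apply rpow_le_rpow_of_nonpos (W_pos hk _) _ (by linarith)
    unfold W
    have := S.hT
    have : 0 < k := by linarith
    gcongr
  have h4 : ε n * (T n ^ 2 / (2 * (2 * k + 2))) ≤ ε n * (T1 ^ 2 / (2 * (2 * k + 2))) := by
    have := S.hT
    have := S.hε
    have : 0 < k := by linarith
    gcongr
  linarith

lemma E_low (hk : 1 ≤ k) (hj : (j : ℝ) = 2 * k)
    (hS : ∀ᶠ n in atTop, Sc j k (ε n) (T n) (v n) (v' n))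
    (hε : Tendsto ε atTop (𝓝 0)) {a : ℝ} (ha : a < (4 * k * (k + 1)) ^ (k + 1) / (2 * k + 2)) :
    ∀ᶠ n in atTop, a < -(T n ^ (j + 1) * v' n (T n)) := by
  have k0 : 0 < k := by linarith
  obtain ⟨T0, hT0, hT0'⟩ := ((AA_tendsto hk hj).eventually_const_lt ha |>.and
    (eventually_gt_atTop 0)).exists
  have hb : 0 < W k T0 ^ (-k) := rpow_pos_of_pos (W_pos hk _) _
  have hq : 0 < 1 + 1 / k := by positivity
  have lim : Tendsto (fun n => T0 ^ (j + 2) / (2 * k + 2) *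
      (max (W k T0 ^ (-k) - ε n * (T0 ^ 2 / (2 * (2 * k + 2)))) 0) ^ (1 + 1 / k)) atTop
      (𝓝 (AA j k T0)) := by
    have h1 : Tendsto (fun n => (max (W k T0 ^ (-k) - ε n * (T0 ^ 2 / (2 * (2 * k + 2)))) 0)) atTop
        (𝓝 (max (W k T0 ^ (-k) - 0 * (T0 ^ 2 / (2 * (2 * k + 2)))) 0)) :=
      (((hε.mul_const _).const_sub _).max tendsto_const_nhds)
    rw [zero_mul, sub_zero, max_eq_left hb.le] at h1
    have h2 := (h1.rpow_const (p := 1 + 1 / k) (Or.inr hq.le)).const_mul (T0 ^ (j + 2) / (2 * k + 2))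
    have e : (W k T0 ^ (-k)) ^ (1 + 1 / k) = W k T0 ^ (-k - 1) := by
      rw [← rpow_mul (W_pos hk _).le]; congr 1; field_simp; ring
    rw [e] at h2
    exact h2
  filter_upwards [hS, lim.eventually_const_lt hT0,
    (T_large hk hS hε).eventually_gt_atTop T0] with n S h1 h2
  refine lt_of_lt_of_le h1 (le_trans ?_ (S.E_mono hT0'.le h2.le le_rfl))
  have h3 := S.v'_upper ⟨hT0', h2⟩
  have h4 := S.v_ge_quad hT0'.le h2.le
  have h5 := S.vpos T0 ⟨hT0', h2⟩
  have h6 : max (W k T0 ^ (-k) - ε n * (T0 ^ 2 / (2 * (2 * k + 2)))) 0 ≤ v n T0 := max_le h4 h5.le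
  have h7 : 0 < T0 ^ (j + 1) := by positivity
  calc _ ≤ T0 ^ (j + 2) / (2 * k + 2) * (v n T0) ^ (1 + 1 / k) := by
        gcongr
    _ = T0 ^ (j + 1) * (T0 * v n T0 ^ (1 + 1 / k) / (2 * k + 2)) := by ring
    _ ≤ T0 ^ (j + 1) * (- v' n T0) := by gcongr
    _ = _ := by ring

lemma E_lim (hk : 1 ≤ k) (hj : (j : ℝ) = 2 * k)
    (hS : ∀ᶠ n in atTop, Sc j k (ε n) (T n) (v n) (v' n))
    (hε : Tendsto ε atTop (𝓝 0)) (hεT : Tendsto (fun n => ε n * T n ^ 2) atTop (𝓝 0)) :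
    Tendsto (fun n => -(T n ^ (j + 1) * v' n (T n))) atTop
      (𝓝 ((4 * k * (k + 1)) ^ (k + 1) / (2 * k + 2))) := by
  rw [tendsto_order]
  refine ⟨fun a ha => E_low hk hj hS hε ha, fun a ha => ?_⟩
  have lim : Tendsto (fun n => (4 * k * (k + 1)) ^ (k + 1) / (2 * k + 2)
      + (4 * k * (k + 1)) ^ k / 2 * (ε n * T n ^ 2)) atTop
      (𝓝 ((4 * k * (k + 1)) ^ (k + 1) / (2 * k + 2))) := by
    simpa using (hεT.const_mul ((4 * k * (k + 1)) ^ k / 2)).const_add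
      ((4 * k * (k + 1)) ^ (k + 1) / (2 * k + 2))
  filter_upwards [hS, lim.eventually_lt_const ha] with n S h
  exact lt_of_le_of_lt S.E_upper_T h

structure GP (j : ℕ) (k : ℝ) (G : ℝ → ℝ) : Prop where
  hc : Continuous G
  hd : ∀ x, 0 < x → HasDerivAt G (x ^ (j + 1) * (W k x ^ (-k)) ^ 2) x
  G0 : G 0 = 0

lemma P_low {G : ℝ → ℝ} (hG : GP j k G) (hk : 1 ≤ k)
    (hS : ∀ᶠ n in atTop, Sc j k (ε n) (T n) (v n) (v' n))
    (hε : Tendsto ε atTop (𝓝 0)) {a T0 : ℝ} (hT0 : 0 ≤ T0) (ha : a < G T0) :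
    ∀ᶠ n in atTop, a * ε n ≤ P j k (ε n) (v n) (v' n) (T n) := by
  have lim : Tendsto (fun n => G T0 - ε n * T0 ^ (j + 4)) atTop (𝓝 (G T0)) := by
    simpa using (hε.mul_const (T0 ^ (j + 4))).const_sub (G T0)
  filter_upwards [hS, lim.eventually_const_lt ha,
    (T_large hk hS hε).eventually_gt_atTop T0] with n S h1 h2
  refine le_trans ?_ (S.P_ge_quad hG.hc hG.hd hG.G0 hT0 h2.le)
  have := S.hε
  nlinarith

lemma bound {G : ℝ → ℝ} (hG : GP j k G) (hk : 1 ≤ k)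
    (hS : ∀ᶠ n in atTop, Sc j k (ε n) (T n) (v n) (v' n))
    (hε : Tendsto ε atTop (𝓝 0)) {M : ℝ} (hM : ∀ᶠ n in atTop, ε n * T n ^ 2 ≤ M) :
    ∃ D : ℝ, 0 < D ∧ ∀ T0 : ℝ, 0 ≤ T0 → 0 < G T0 → ∀ᶠ n in atTop, ε n * T n ^ j ≤ D / G T0 := by
  have k0 : 0 < k := by linarith
  refine ⟨((4 * k * (k + 1)) ^ (k + 1) / (2 * k + 2) + (4 * k * (k + 1)) ^ k / 2 * M) ^ 2 + 1,
    by positivity, fun T0 hT0 hG0 => ?_⟩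
  filter_upwards [hS, hM, P_low hG hk hS hε hT0 (half_lt_self hG0)] with n S h1 h2
  have h3 := S.E_upper_T
  have h4 := S.E_nonneg
  have h5 := S.poh
  have h6 : -(T n ^ (j + 1) * v' n (T n)) ≤ ((4 * k * (k + 1)) ^ (k + 1) / (2 * k + 2)
    + (4 * k * (k + 1)) ^ k / 2 * M) := by
    refine h3.trans ?_
    gcongr
  have h7 := pow_le_pow_left₀ h4 h6 2
  rw [h5] at h7
  have hT : 0 < T n ^ j := pow_pos S.hT j
  have h8 : 2 * T n ^ j * (G T0 / 2 * ε n) ≤ 2 * T n ^ j * P j k (ε n) (v n) (v' n) (T n) := by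
    gcongr
  rw [le_div_iff₀ hG0]
  nlinarith

lemma final_big {G : ℝ → ℝ} (hG : GP j k G) (hk : 1 ≤ k) (hj : (j : ℝ) = 2 * k) (hj2 : 3 ≤ j)
    (hS : ∀ᶠ n in atTop, Sc j k (ε n) (T n) (v n) (v' n))
    (hε : Tendsto ε atTop (𝓝 0)) {M : ℝ} (hM : ∀ᶠ n in atTop, ε n * T n ^ 2 ≤ M)
    {C : ℝ} (hC : 0 < C) (hGC : Tendsto G atTop (𝓝 C)) :
    Tendsto (fun n => -(T n ^ (j + 1) * v' n (T n))) atTop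
      (𝓝 ((4 * k * (k + 1)) ^ (k + 1) / (2 * k + 2))) ∧
    Tendsto (fun n => ε n * T n ^ j) atTop
      (𝓝 (((4 * k * (k + 1)) ^ (k + 1) / (2 * k + 2)) ^ 2 / (2 * C))) := by
  obtain ⟨D, hD, hb⟩ := bound hG hk hS hε hM
  obtain ⟨T0, hT0, hT0'⟩ := (hGC.eventually_const_lt hC |>.and (eventually_ge_atTop 0)).exists
  have hTl := T_large hk hS hε
  have hεT : Tendsto (fun n => ε n * T n ^ 2) atTop (𝓝 0) := by
    have l1 : Tendsto (fun n => D / G T0 * (T n)⁻¹) atTop (𝓝 0) := by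
      simpa using (tendsto_inv_atTop_zero.comp hTl).const_mul (D / G T0)
    refine squeeze_zero' ?_ ?_ l1
    · filter_upwards [hS] with n S
      have := S.hε
      positivity
    · filter_upwards [hS, hb T0 hT0' hT0, hTl.eventually_ge_atTop 1] with n S h1 h2
      have hT := S.hT
      have hε := S.hε
      rw [← div_eq_mul_inv, le_div_iff₀ hT]
      refine le_trans ?_ h1
      calc ε n * T n ^ 2 * T n = ε n * T n ^ 3 := by ring
        _ ≤ _ := by gcongr
  have hE := E_lim hk hj hS hε hεT
  refine ⟨hE, ?_⟩
  have hP : Tendsto (fun n => P j k (ε n) (v n) (v' n) (T n) / ε n) atTop (𝓝 C) := by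
    rw [tendsto_order]
    constructor
    · intro a ha
      obtain ⟨a', ha1, ha2⟩ := exists_between ha
      obtain ⟨T1, hT1, hT1'⟩ := (hGC.eventually_const_lt ha2 |>.and (eventually_ge_atTop 0)).exists
      filter_upwards [hS, P_low hG hk hS hε hT1' hT1] with n S h
      exact lt_of_lt_of_le ha1 ((le_div_iff₀ S.hε).2 h)
    · intro a ha
      filter_upwards [hS, (hGC.comp hTl).eventually_lt_const ha] with n S h
      refine lt_of_le_of_lt ?_ h
      rw [div_le_iff₀ S.hε]
      have := S.P_le hG.hc hG.hd hG.G0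
      simp only [Function.comp]
      linarith
  have := (hE.pow 2).div (hP.const_mul 2) (by positivity)
  refine this.congr' ?_
  filter_upwards [hS, hP.eventually_const_lt hC] with n S h
  have hε := S.hε
  have hPp : 0 < P j k (ε n) (v n) (v' n) (T n) := by
    rwa [lt_div_iff₀ hε, zero_mul] at h
  simp only [Pi.div_apply]
  rw [S.poh]
  field_simp

end BN
namespace BN
open Sc

lemma bsq {j : ℕ} {k : ℝ} (hk : 1 ≤ k) (hj : (j : ℝ) = 2 * k) (x : ℝ) :
    (W k x ^ (-k)) ^ 2 = (W k x ^ j)⁻¹ := by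
  have hW := W_pos hk x
  rw [← rpow_natCast, ← rpow_mul hW.le, ← rpow_natCast, ← rpow_neg hW.le, hj]
  congr 1
  push_cast
  ring

lemma GP6 : GP 4 2 (fun t => 2304 * (t ^ 2 / (24 + t ^ 2)) ^ 3) := by
  have h24 : ∀ t : ℝ, 24 + t ^ 2 ≠ 0 := fun t => by positivity
  refine ⟨?_, ?_, by simp⟩
  · fun_prop (disch := exact h24 _)
  · intro x hx
    rw [bsq (j := 4) (by norm_num) (by norm_num)]
    have d := ((((hasDerivAt_pow 2 x).div ((hasDerivAt_pow 2 x).const_add 24) (h24 x)).pow 3).const_mul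
      2304)
    refine d.congr_deriv ?_
    have := h24 x
    have e : W 2 x = (24 + x ^ 2) / 24 := by unfold W; ring
    rw [e]
    simp only [Pi.div_apply, Nat.cast_ofNat, Nat.reduceSub, pow_one, div_pow]
    field_simp
    ring

lemma G6_lim : Tendsto (fun t : ℝ => 2304 * (t ^ 2 / (24 + t ^ 2)) ^ 3) atTop (𝓝 2304) := by
  have h : Tendsto (fun t : ℝ => 1 - 24 * (24 + t ^ 2)⁻¹) atTop (𝓝 (1 - 24 * 0)) := by
    refine ((tendsto_inv_atTop_zero.comp ?_).const_mul 24).const_sub 1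
    exact tendsto_atTop_add_const_left _ _ (tendsto_pow_atTop two_ne_zero)
  have h2 := (h.pow 3).const_mul 2304
  simp only [mul_zero, sub_zero, one_pow, mul_one] at h2
  refine h2.congr (fun t => ?_)
  have : 24 + t ^ 2 ≠ 0 := by positivity
  congr 2
  field_simp
  ring

noncomputable def G5 (t : ℝ) : ℝ := 225 * √15 * (3 / 8 * arctan (t / √15)
  - (t / √15) * (5 * (t / √15) ^ 2 + 3) / (8 * (1 + (t / √15) ^ 2) ^ 2))

lemma GP5 : GP 3 (3/2) G5 := by
  have hs : ∀ t : ℝ, 8 * (1 + (t / √15) ^ 2) ^ 2 ≠ 0 := fun t => by positivity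
  have ha : (√15) ^ 2 = (15 : ℝ) := Real.sq_sqrt (by norm_num)
  have ha0 : 0 < √(15 : ℝ) := by positivity
  have key : ∀ s : ℝ, HasDerivAt (fun s : ℝ => 3 / 8 * arctan s
      - s * (5 * s ^ 2 + 3) / (8 * (1 + s ^ 2) ^ 2)) (s ^ 4 / (1 + s ^ 2) ^ 3) s := by
    intro s
    have h1 : 8 * (1 + s ^ 2) ^ 2 ≠ 0 := by positivity
    have d := ((hasDerivAt_arctan s).const_mul (3 / 8)).sub
      (((hasDerivAt_id s).mul (((hasDerivAt_pow 2 s).const_mul 5).add_const 3)).div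
        (((((hasDerivAt_pow 2 s).const_add 1).pow 2)).const_mul 8) h1)
    refine d.congr_deriv ?_
    simp only [Pi.mul_apply, id, Pi.pow_apply]
    have : 1 + s ^ 2 ≠ 0 := by positivity
    field_simp
    push_cast
    ring
  have hd : ∀ x, HasDerivAt G5 (x ^ (3 + 1) * (W (3/2) x ^ (-(3/2:ℝ))) ^ 2) x := by
    intro x
    rw [bsq (j := 3) (by norm_num) (by norm_num)]
    have d := ((key (x / √15)).comp x ((hasDerivAt_id x).div_const √15)).const_mul (225 * √15)
    refine d.congr_deriv ?_
    have e : W (3/2) x = 1 + (x / √15) ^ 2 := by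
      unfold W; rw [div_pow, ha]; norm_num
    rw [e]
    have e2 : x ^ (3 + 1) = 225 * (x / √15) ^ 4 := by
      rw [div_pow, show √(15:ℝ) ^ 4 = (√15 ^ 2) ^ 2 by ring, ha]; ring
    rw [e2]
    field_simp
  refine ⟨?_, fun x _ => hd x, by simp [G5]⟩
  exact continuous_iff_continuousAt.2 fun t => (hd t).continuousAt

lemma G5_lim : Tendsto G5 atTop (𝓝 (225 * √15 * (3 * π / 16))) := by
  have ha0 : 0 < √(15 : ℝ) := by positivity
  have hs : Tendsto (fun t : ℝ => t / √15) atTop atTop := tendsto_id.atTop_div_const ha0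
  have key : Tendsto (fun s : ℝ => 3 / 8 * arctan s
      - s * (5 * s ^ 2 + 3) / (8 * (1 + s ^ 2) ^ 2)) atTop (𝓝 (3 / 8 * (π / 2) - 0)) := by
    refine Tendsto.sub ((tendsto_arctan_atTop.mono_right nhdsWithin_le_nhds).const_mul _) ?_
    refine squeeze_zero' ?_ ?_ (tendsto_inv_atTop_zero)
    · filter_upwards [eventually_ge_atTop 0] with s hs
      positivity
    · filter_upwards [eventually_gt_atTop 0] with s hs
      rw [div_le_iff₀ (by positivity), ← div_eq_inv_mul, le_div_iff₀ hs]
      nlinarith [sq_nonneg s, sq_nonneg (s ^ 2)]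
  have h := (key.comp hs).const_mul (225 * √15)
  refine (h.congr fun t => ?_).trans_eq ?_
  · simp [G5]
  · congr 1; ring

lemma GP4 : GP 2 1 (fun t => 32 * (log (W 1 t) + (W 1 t)⁻¹ - 1)) := by
  have h1 : (1 : ℝ) ≤ 1 := le_rfl
  have hW := W_pos h1
  have hd : ∀ x, HasDerivAt (fun t => 32 * (log (W 1 t) + (W 1 t)⁻¹ - 1))
      (x ^ (2 + 1) * (W 1 x ^ (-(1:ℝ))) ^ 2) x := by
    intro x
    rw [bsq (j := 2) le_rfl (by norm_num)]
    have d := ((((W_deriv h1 x).log (hW x).ne').add ((W_deriv h1 x).inv (hW x).ne')).sub_const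
      1).const_mul 32
    refine d.congr_deriv ?_
    have := (hW x).ne'
    have e : x ^ 2 = 8 * (W 1 x - 1) := by unfold W; ring
    field_simp
    rw [show x ^ (2 + 1) = x * x ^ 2 by ring, e]
    ring
  refine ⟨?_, fun x _ => hd x, by simp [W]⟩
  exact continuous_iff_continuousAt.2 fun t => (hd t).continuousAt

lemma G4_lim : Tendsto (fun t => 32 * (log (W 1 t) + (W 1 t)⁻¹ - 1)) atTop atTop := by
  have h1 : (1 : ℝ) ≤ 1 := le_rfl
  have h2 : Tendsto (fun t => 32 * (log (W 1 t) - 1)) atTop atTop :=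
    (tendsto_atTop_add_const_right _ (-1) (tendsto_log_atTop.comp (W_tendsto h1))).const_mul_atTop
      (by norm_num)
  refine tendsto_atTop_mono (fun t => ?_) h2
  have : 0 < (W 1 t)⁻¹ := inv_pos.2 (W_pos h1 t)
  linarith

section four
variable {ε T : ℝ} {v v' : ℝ → ℝ}

lemma four_v_ge (S : Sc 2 1 ε T v v') {t : ℝ} (h0 : 0 ≤ t) (ht : t ≤ T) :
    (W 1 t)⁻¹ - ε * (4 * log (W 1 t)) ≤ v t := by
  have h1 : (1 : ℝ) ≤ 1 := le_rfl
  have h8 : ∀ t : ℝ, 8 + t ^ 2 ≠ 0 := fun t => by positivity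
  have hW : ∀ x, W 1 x = (8 + x ^ 2) / 8 := fun x => by unfold W; ring
  rw [← rpow_neg_one]
  refine S.v_ge (H := fun t => 8 * t ^ 4 / (8 + t ^ 2))
    (h := fun t => 8 * t ^ 3 * (32 + 2 * t ^ 2) / (8 + t ^ 2) ^ 2)
    (L := fun t => 4 * log (W 1 t)) (l := fun t => 8 * t / (8 + t ^ 2))
    (by fun_prop (disch := exact h8 _)) ?_ ?_ (by simp) ?_ ?_ (by simp [W]) ?_ h0 ht
  · intro x hx
    refine (((hasDerivAt_pow 4 x).const_mul 8).div ((hasDerivAt_pow 2 x).const_add 8)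
      (h8 x)).congr_deriv ?_
    have := h8 x
    field_simp
    push_cast
    ring
  · intro x hx
    rw [rpow_neg_one, hW]
    have := h8 x
    have e : x ^ (2 + 1) * ((8 + x ^ 2) / 8)⁻¹ = 8 * x ^ 3 * (8 + x ^ 2) / (8 + x ^ 2) ^ 2 := by
      field_simp
    rw [e]
    gcongr 8 * x ^ 3 * ?_ / _
    nlinarith
  · exact ((W_cont 1).log (fun x => (W_pos h1 x).ne')).const_mul 4
  · intro x hx
    refine (((W_deriv h1 x).log (W_pos h1 x).ne').const_mul 4).congr_deriv ?_
    have := h8 x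
    rw [hW]
    field_simp
    norm_num
  · intro x hx
    ring

lemma four_P_ge (S : Sc 2 1 ε T v v') {t : ℝ} (h0 : 0 ≤ t) (ht : t ≤ T) :
    ε * (32 * (log (W 1 t) - 1) - 32 * t ^ 2 * ε * log (W 1 t)) ≤ P 2 1 ε v v' T := by
  have h1 : (1 : ℝ) ≤ 1 := le_rfl
  have hε := S.hε
  have key := S.P_ge (F := fun s => 32 * (log (W 1 s) + (W 1 s)⁻¹ - 1)
    - s ^ 2 * (32 * ε * log (W 1 t)))
    (f := fun s => s ^ (2 + 1) * (W 1 s ^ (-(1:ℝ))) ^ 2 - (((2:ℕ):ℝ) * s ^ (2-1)) * (32 * ε * log (W 1 t)))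
    h0 ht ?_ ?_ ?_ ?_
  · refine le_trans ?_ key
    have : 0 < (W 1 t)⁻¹ := inv_pos.2 (W_pos h1 t)
    apply mul_le_mul_of_nonneg_left _ hε.le
    nlinarith
  · exact GP4.hc.sub (by fun_prop)
  · intro x hx
    exact (GP4.hd x hx.1).sub ((hasDerivAt_pow 2 x).mul_const _)
  · intro x hx
    have hx' : x ∈ Ioo 0 T := ⟨hx.1, hx.2.trans_le ht⟩
    have hv := four_v_ge S hx'.1.le hx'.2.le
    have hWx := W_pos h1 x
    have hs := sq_ge (inv_pos.2 hWx).le (S.vpos x hx').le hv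
    have hle : log (W 1 x) ≤ log (W 1 t) := by
      apply log_le_log hWx
      unfold W
      have := hx.1
      have := hx.2
      gcongr
    have hl0 : 0 ≤ log (W 1 x) := log_nonneg (W_ge h1 x)
    have hx0 := hx.1
    have h3 : x ^ 2 * (W 1 x)⁻¹ ≤ 8 := by
      have := sq_div_W_le h1 x
      rw [div_eq_mul_inv] at this
      linarith
    have h4 : x ^ 2 * (W 1 x)⁻¹ * (8 * x * (ε * log (W 1 x))) ≤ 8 * (8 * x * (ε * log (W 1 t))) := by
      gcongr
    rw [rpow_neg_one]
    have hp : 0 < x ^ 3 := by positivity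
    have h5 := mul_le_mul_of_nonneg_left hs hp.le
    rw [inv_pow] at h5
    norm_num
    linarith
  · simp [W]

end four

section four_lim
variable {ε T : ℕ → ℝ} {v v' : ℕ → ℝ → ℝ}

lemma final_four (hS : ∀ᶠ n in atTop, Sc 2 1 (ε n) (T n) (v n) (v' n))
    (hε : Tendsto ε atTop (𝓝 0)) {M : ℝ} (hM : ∀ᶠ n in atTop, ε n * T n ^ 2 ≤ M) :
    Tendsto (fun n => ε n * T n ^ 2) atTop (𝓝 0) ∧
    Tendsto (fun n => -(T n ^ 3 * v' n (T n))) atTop (𝓝 16) ∧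
    Tendsto (fun n => ε n * T n ^ 2 * (- log (ε n))) atTop (𝓝 4) := by
  have h1 : (1 : ℝ) ≤ 1 := le_rfl
  obtain ⟨D, hD, hb⟩ := bound GP4 h1 hS hε hM
  have hεT : Tendsto (fun n => ε n * T n ^ 2) atTop (𝓝 0) := by
    rw [tendsto_order]
    constructor
    · intro a ha
      filter_upwards [hS] with n S
      have := S.hε
      have := S.hT
      exact lt_of_lt_of_le ha (by positivity)
    · intro a ha
      obtain ⟨T0, hT0, hT0'⟩ := (G4_lim.eventually_gt_atTop (D / a) |>.and
        (eventually_ge_atTop 0)).exists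
      have hp : 0 < 32 * (log (W 1 T0) + (W 1 T0)⁻¹ - 1) := lt_trans (by positivity) hT0
      filter_upwards [hb T0 hT0' hp] with n h
      refine lt_of_le_of_lt h ?_
      rw [div_lt_iff₀ ha] at hT0
      rw [div_lt_iff₀ hp]
      linarith
  have hE : Tendsto (fun n => -(T n ^ 3 * v' n (T n))) atTop (𝓝 16) := by
    have := E_lim h1 (by norm_num) hS hε hεT
    norm_num at this ⊢
    exact this
  refine ⟨hεT, hE, ?_⟩
  have hE2 : Tendsto (fun n => (-(T n ^ 3 * v' n (T n))) ^ 2 / 64) atTop (𝓝 4) := by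
    have := (hE.pow 2).div_const 64
    norm_num at this ⊢
    exact this
  rw [tendsto_order]
  constructor
  · intro a ha
    have l2 : Tendsto (fun n => ε n + ε n * T n ^ 2 / 8) atTop (𝓝 0) := by
      simpa using hε.add (hεT.div_const 8)
    filter_upwards [hS, hE2.eventually_const_lt ha, l2.eventually_lt_const one_pos] with n S h2 h3
    refine lt_of_lt_of_le h2 ?_
    have he := S.hε
    have hT := S.hT
    have hp := S.poh
    norm_num at hp
    have hP := S.P_le GP4.hc GP4.hd GP4.G0
    have hW := W_pos h1 (T n)
    have hW1 : (W 1 (T n))⁻¹ ≤ 1 := inv_le_one_of_one_le₀ (W_ge h1 _)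
    have hlog : log (W 1 (T n)) ≤ - log (ε n) := by
      rw [← log_inv]
      apply log_le_log hW
      rw [← one_div, le_div_iff₀ he]
      unfold W
      linarith
    have h5 : P 2 1 (ε n) (v n) (v' n) (T n) ≤ ε n * (32 * (- log (ε n))) := by
      refine hP.trans ?_
      apply mul_le_mul_of_nonneg_left _ he.le
      linarith
    have h6 : 2 * T n ^ 2 * P 2 1 (ε n) (v n) (v' n) (T n) ≤
      2 * T n ^ 2 * (ε n * (32 * (- log (ε n)))) := by gcongr
    have h7 : (-(T n ^ 3 * v' n (T n))) ^ 2 = 2 * T n ^ 2 * P 2 1 (ε n) (v n) (v' n) (T n) := by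
      rw [← hp]; ring
    rw [h7, div_le_iff₀ (by norm_num)]
    linarith
  · intro a ha
    obtain ⟨δ, hδ0, hδ1, hδ⟩ : ∃ δ : ℝ, 0 < δ ∧ δ < 1 ∧ 4 / (1 - δ) < a := by
      have : Tendsto (fun δ : ℝ => 4 / (1 - δ)) (𝓝[>] 0) (𝓝 4) := by
        have h : ContinuousAt (fun δ : ℝ => 4 / (1 - δ)) 0 :=
          continuousAt_const.div (continuousAt_const.sub continuousAt_id) (by norm_num)
        have := h.tendsto
        norm_num at this
        exact this.mono_left nhdsWithin_le_nhds
      obtain ⟨δ, h2, h3⟩ := (this.eventually_lt_const ha |>.and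
        (Ioo_mem_nhdsGT (one_pos : (0:ℝ) < 1))).exists
      exact ⟨δ, h3.1, h3.2, h2⟩
    have hεp : ∀ᶠ n in atTop, 0 < ε n := hS.mono fun n S => S.hε
    have l1 : Tendsto (fun n => ε n ^ δ) atTop (𝓝 0) := by
      have := hε.rpow_const (p := δ) (Or.inr hδ0.le)
      rwa [zero_rpow hδ0.ne'] at this
    have l2 : Tendsto (fun n => 4 * (1 - δ) * (-(log (ε n) * ε n ^ δ))) atTop (𝓝 0) := by
      have h := (tendsto_log_mul_rpow_nhdsGT_zero hδ0).comp
        (tendsto_nhdsWithin_iff.2 ⟨hε, hεp⟩)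
      simpa using h.neg.const_mul (4 * (1 - δ))
    have l3 : Tendsto (fun n => ((-(T n ^ 3 * v' n (T n))) ^ 2 / 64 + ε n * T n ^ 2) /
        ((1 - δ) * (1 - 8 * ε n ^ δ))) atTop (𝓝 ((4 + 0) / ((1 - δ) * (1 - 8 * 0)))) := by
      refine (hE2.add hεT).div (((l1.const_mul 8).const_sub 1).const_mul (1 - δ)) ?_
      simp
      linarith
    rw [add_zero, mul_zero, sub_zero, mul_one] at l3
    filter_upwards [hS, l2.eventually_lt_const one_pos, l3.eventually_lt_const hδ,
      l1.eventually_lt_const (show (0:ℝ) < 1 / 8 by norm_num), hε.eventually_lt_const one_pos]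
      with n S h2 h3 h4 h5
    refine lt_of_le_of_lt ?_ h3
    have he := S.hε
    have hT := S.hT
    set X := ε n ^ (-(1 - δ)) with hX
    have hXp : 0 < X := rpow_pos_of_pos he _
    have hX1 : 1 ≤ X := one_le_rpow_of_pos_of_le_one_of_nonpos he h5.le (by linarith)
    have hXe : ε n * X = ε n ^ δ := by
      rw [hX, ← rpow_one_add' he.le]
      · congr 1; ring
      · rw [show 1 + -(1 - δ) = δ by ring]; exact hδ0.ne'
    have hXl : log X = (1 - δ) * (- log (ε n)) := by
      rw [hX, log_rpow he]; ring
    set T0 := √(8 * (X - 1)) with hT0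
    have hT0s : T0 ^ 2 = 8 * (X - 1) := Real.sq_sqrt (by linarith)
    have hT00 : 0 ≤ T0 := Real.sqrt_nonneg _
    have hWX : W 1 T0 = X := by unfold W; rw [hT0s]; ring
    have hTT : T0 ≤ T n := by
      by_contra hc
      push Not at hc
      have hv := four_v_ge S hT.le le_rfl
      rw [S.vT] at hv
      have hWp := W_pos h1 (T n)
      have hWle : W 1 (T n) ≤ X := by
        rw [← hWX]
        unfold W
        gcongr
      have hl : log (W 1 (T n)) ≤ log X := log_le_log hWp hWle
      have hi : X⁻¹ ≤ (W 1 (T n))⁻¹ := inv_anti₀ hWp hWle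
      have h6 : X⁻¹ ≤ ε n * (4 * log X) := by
        have : ε n * (4 * log (W 1 (T n))) ≤ ε n * (4 * log X) := by gcongr
        linarith
      have h7 : 1 ≤ ε n * (4 * log X) * X := by
        calc 1 = X⁻¹ * X := by field_simp
          _ ≤ _ := by gcongr
      have h8 : ε n * (4 * log X) * X = 4 * (1 - δ) * (-(log (ε n) * ε n ^ δ)) := by
        rw [← hXe, hXl]; ring
      linarith
    have hP := four_P_ge S hT00 hTT
    rw [hWX, hT0s] at hP
    have hp := S.poh
    norm_num at hp
    have h7 : (-(T n ^ 3 * v' n (T n))) ^ 2 = 2 * T n ^ 2 * P 2 1 (ε n) (v n) (v' n) (T n) := by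
      rw [← hp]; ring
    have hlX : 0 ≤ log X := log_nonneg hX1
    have h8 : ε n * (32 * (log X - 1) - 256 * ε n ^ δ * log X) ≤
        P 2 1 (ε n) (v n) (v' n) (T n) := by
      refine le_trans ?_ hP
      apply mul_le_mul_of_nonneg_left _ he.le
      rw [← hXe]
      have : 0 ≤ ε n * log X := by positivity
      nlinarith
    have h9 : 2 * T n ^ 2 * (ε n * (32 * (log X - 1) - 256 * ε n ^ δ * log X)) ≤
        2 * T n ^ 2 * P 2 1 (ε n) (v n) (v' n) (T n) := by gcongr
    rw [h7, le_div_iff₀ (mul_pos (by linarith) (by linarith))]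
    rw [hXl] at h9
    linarith
end four_lim

end BN
namespace BN
open Sc

lemma u_pos {u : ℝ → ℝ} {R : ℝ} (hc : ContinuousOn u (Icc 0 1)) (h0 : 0 < u 0)
    (hR : IsFirstZero u R) {x : ℝ} (hx : x ∈ Ioo 0 R) : 0 < u x := by
  by_contra hn
  push Not at hn
  have hx1 : x ≤ 1 := hx.2.le.trans hR.1.2
  obtain ⟨y, hy, hy0⟩ := intermediate_value_Icc' hx.1.le (hc.mono (Icc_subset_Icc le_rfl hx1))
    (show (0:ℝ) ∈ Icc (u x) (u 0) from ⟨hn, h0.le⟩)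
  have hyp : 0 < y := by
    rcases eq_or_lt_of_le hy.1 with h | h
    · rw [← h] at hy0; linarith
    · exact h
  exact hR.2.2 y ⟨hyp, hy.2.trans_lt hx.2⟩ hy0

lemma rescale {j m : ℕ} {k lam R : ℝ} {u u' u'' : ℝ → ℝ} (hj : (j : ℝ) = 2 * k) (hk : 1 ≤ k)
    (hs : BNSol (j + 2) lam m u u' u'') (hR : IsFirstZero u R) (hlam : 0 < lam)
    {μ : ℝ} (hμ : μ = u 0 ^ (1 / k)) :
    Sc j k (lam / μ ^ 2) (μ * R) (fun t => u (t / μ) / u 0) (fun t => u' (t / μ) / (u 0 * μ)) := by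
  have k0 : 0 < k := by linarith
  have hγ := hs.pos_zero
  have hμ0 : 0 < μ := by rw [hμ]; positivity
  have hR0 := hR.1.1
  have hR1 := hR.1.2
  have cu : ContinuousOn u (Icc 0 1) := fun x hx => (hs.deriv_fst x hx).continuousWithinAt
  have cu' : ContinuousOn u' (Icc 0 1) := fun x hx => (hs.deriv_snd x hx).continuousWithinAt
  have hmap : MapsTo (fun t : ℝ => t / μ) (Icc 0 (μ * R)) (Icc 0 1) := by
    intro t ht
    refine ⟨div_nonneg ht.1 hμ0.le, ?_⟩
    rw [div_le_one hμ0]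
    nlinarith [ht.2]
  have hmap2 : ∀ t ∈ Ioo 0 (μ * R), t / μ ∈ Ioo 0 R := by
    intro t ht
    refine ⟨div_pos ht.1 hμ0, ?_⟩
    rw [div_lt_iff₀ hμ0]
    linarith [ht.2]
  have hm3 : ∀ t ∈ Ioo 0 (μ * R), t / μ ∈ Ioo (0:ℝ) 1 := fun t ht =>
    ⟨(hmap2 t ht).1, (hmap2 t ht).2.trans_le hR1⟩
  have cd : ContinuousOn (fun t : ℝ => t / μ) (Icc 0 (μ * R)) := by fun_prop
  have dd : ∀ t : ℝ, HasDerivAt (fun t : ℝ => t / μ) (1 / μ) t := fun t =>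
    (hasDerivAt_id t).div_const μ
  refine ⟨hj, hk, by positivity, by positivity, (cu.comp cd hmap).div_const _,
    (cu'.comp cd hmap).div_const _, ?_, ?_, ?_, ?_, ?_⟩
  · intro t ht
    have h1 := hm3 t ht
    have d := (hs.deriv_fst _ (Ioo_subset_Icc_self h1)).hasDerivAt (Icc_mem_nhds h1.1 h1.2)
    refine ((d.comp t (dd t)).div_const (u 0)).congr_deriv ?_
    field_simp
  · intro t ht
    have h1 := hm3 t ht
    have hup := u_pos cu hγ hR (hmap2 t ht)
    have d := (hs.deriv_snd _ (Ioo_subset_Icc_self h1)).hasDerivAt (Icc_mem_nhds h1.1 h1.2)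
    refine ((d.comp t (dd t)).div_const (u 0 * μ)).congr_deriv ?_
    have ode := hs.ode _ h1
    have ht0 := ht.1
    have e1 : (4:ℝ) / (((j + 2 : ℕ) : ℝ) - 2) = 2 / k := by
      push_cast; rw [hj, show 2 * k + 2 - 2 = 2 * k by ring]; field_simp; norm_num
    have e2 : (((j + 2 : ℕ) : ℝ) - 1) = 2 * k + 1 := by push_cast; rw [hj]; ring
    rw [e1, e2, abs_of_pos hup] at ode
    have e3 : (u (t / μ) / u 0) ^ (1 + 2 / k) = u (t / μ) ^ (2 / k) * u (t / μ) / (u 0 * μ ^ 2) := by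
      rw [div_rpow hup.le hγ.le, rpow_add hup, rpow_add hγ, rpow_one, rpow_one]
      have : u 0 ^ (2 / k) = μ ^ 2 := by
        rw [hμ, ← rpow_natCast, ← rpow_mul hγ.le]; congr 1; push_cast; ring
      rw [this]
      ring
    rw [e3]
    generalize u (t / μ) ^ (2 / k) * u (t / μ) = y at *
    have e4 : u'' (t / μ) = -((2 * k + 1) / (t / μ) * u' (t / μ)) - y - lam * u (t / μ) := by linarith
    rw [e4]
    field_simp
  · simp; exact hγ.ne'
  · have : μ * R / μ = R := by field_simp
    simp [this, hR.2.1]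
  · intro t ht
    exact div_pos (u_pos cu hγ hR (hmap2 t ht)) hγ

section
variable {j m : ℕ} {k lamBar : ℝ} {lam r : ℕ → ℝ} {u u' u'' : ℕ → ℝ → ℝ}

lemma mu_pow (hk : 1 ≤ k) (hj : (j : ℝ) = 2 * k) {γ : ℝ} (hγ : 0 < γ) :
    (γ ^ (1 / k)) ^ j = γ ^ 2 := by
  have k0 : 0 < k := by linarith
  rw [← rpow_natCast, ← rpow_mul hγ.le, hj, ← rpow_natCast]
  congr 1
  push_cast
  field_simp

lemma E_conv (hk : 1 ≤ k) (hj : (j : ℝ) = 2 * k) {γ R d : ℝ} (hγ : 0 < γ) :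
    -((γ ^ (1 / k) * R) ^ (j + 1) * (d / (γ * γ ^ (1 / k)))) = -(γ * R ^ (j + 1) * d) := by
  have hp : 0 < γ ^ (1 / k) := by positivity
  rw [mul_pow, pow_succ, mu_pow hk hj hγ]
  field_simp

lemma setup (hj : (j : ℝ) = 2 * k) (hk : 1 ≤ k) (hlamBar : 0 < lamBar)
    (hlam : Tendsto lam atTop (𝓝 lamBar))
    (hsol : ∀ n, BNSol (j + 2) (lam n) m (u n) (u' n) (u'' n))
    (hfz : ∀ n, IsFirstZero (u n) (r n))
    (hblow : Tendsto (fun n => u n 0) atTop atTop) :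
    (∀ᶠ n in atTop, Sc j k (lam n / (u n 0 ^ (1 / k)) ^ 2) (u n 0 ^ (1 / k) * r n)
      (fun t => u n (t / u n 0 ^ (1 / k)) / u n 0)
      (fun t => u' n (t / u n 0 ^ (1 / k)) / (u n 0 * u n 0 ^ (1 / k)))) ∧
    Tendsto (fun n => lam n / (u n 0 ^ (1 / k)) ^ 2) atTop (𝓝 0) ∧
    (∀ᶠ n in atTop, lam n / (u n 0 ^ (1 / k)) ^ 2 * (u n 0 ^ (1 / k) * r n) ^ 2 ≤ lamBar + 1) := by
  have k0 : 0 < k := by linarith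
  have hlp := hlam.eventually_const_lt hlamBar
  refine ⟨?_, ?_, ?_⟩
  · filter_upwards [hlp] with n hn
    exact rescale hj hk (hsol n) (hfz n) hn rfl
  · have h1 : Tendsto (fun n => (u n 0 ^ (1 / k)) ^ 2) atTop atTop :=
      (tendsto_pow_atTop two_ne_zero).comp ((tendsto_rpow_atTop (by positivity)).comp hblow)
    exact hlam.div_atTop h1
  · filter_upwards [hlp, hlam.eventually_lt_const (lt_add_one lamBar)] with n h1 h2
    have hγ := (hsol n).pos_zero
    have hp : 0 < u n 0 ^ (1 / k) := by positivity
    have e : lam n / (u n 0 ^ (1 / k)) ^ 2 * (u n 0 ^ (1 / k) * r n) ^ 2 = lam n * r n ^ 2 := by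
      field_simp
    rw [e]
    have h3 := (hfz n).1.1
    have h4 := (hfz n).1.2
    have : r n ^ 2 ≤ 1 := pow_le_one₀ h3.le h4
    nlinarith

lemma case4 (hlamBar : 0 < lamBar)
    (hlam : Tendsto lam atTop (𝓝 lamBar))
    (hsol : ∀ n, BNSol 4 (lam n) m (u n) (u' n) (u'' n))
    (hfz : ∀ n, IsFirstZero (u n) (r n))
    (hblow : Tendsto (fun n => u n 0) atTop atTop) :
    Tendsto (fun n => r n ^ 2 * Real.log (u n 0)) atTop (𝓝 (2 / lamBar)) ∧
      Tendsto (fun n => u' n (r n) * u n 0 * r n ^ 3) atTop (𝓝 (-16)) := by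
  obtain ⟨hS, hε, hM⟩ := setup (j := 2) (k := 1) (by norm_num) le_rfl hlamBar hlam hsol hfz hblow
  obtain ⟨f1, f2, f3⟩ := final_four hS hε hM
  simp only [div_one, rpow_one] at f1 f2 f3
  have hlp := hlam.eventually_const_lt hlamBar
  have hr2 : Tendsto (fun n => r n ^ 2) atTop (𝓝 0) := by
    have := f1.div hlam hlamBar.ne'
    rw [zero_div] at this
    refine this.congr' ?_
    filter_upwards [hlp] with n hn
    have hγ := (hsol n).pos_zero
    simp only [Pi.div_apply]
    field_simp
  constructor
  · have hll := hlam.log hlamBar.ne'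
    have := ((f3.div hlam hlamBar.ne').add (hr2.mul hll)).div_const 2
    rw [zero_mul, add_zero, show 4 / lamBar / 2 = 2 / lamBar by ring] at this
    refine this.congr' ?_
    filter_upwards [hlp] with n hn
    have hγ := (hsol n).pos_zero
    simp only [Pi.div_apply]
    rw [log_div hn.ne' (by positivity), log_pow]
    push_cast
    field_simp
    ring
  · refine (f2.neg).congr (fun n => ?_)
    have hγ := (hsol n).pos_zero
    have : u n 0 * r n / u n 0 = r n := by field_simp
    rw [this]
    field_simp

lemma case6 (hlamBar : 0 < lamBar)
    (hlam : Tendsto lam atTop (𝓝 lamBar))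
    (hsol : ∀ n, BNSol 6 (lam n) m (u n) (u' n) (u'' n))
    (hfz : ∀ n, IsFirstZero (u n) (r n))
    (hblow : Tendsto (fun n => u n 0) atTop atTop) :
    Tendsto (fun n => u n 0 * r n ^ 4) atTop (𝓝 (1152 / lamBar)) ∧
      Tendsto (fun n => u' n (r n) * r n) atTop (𝓝 (-2 * lamBar)) := by
  have h2 : (1:ℝ) ≤ 2 := by norm_num
  have hj : ((4:ℕ):ℝ) = 2 * 2 := by norm_num
  obtain ⟨hS, hε, hM⟩ := setup (j := 4) (k := 2) hj h2 hlamBar hlam hsol hfz hblow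
  obtain ⟨f1, f2⟩ := final_big GP6 h2 hj (by norm_num) hS hε hM (by norm_num) G6_lim
  have eA : (4 * 2 * (2 + 1) : ℝ) ^ ((2:ℝ) + 1) / (2 * 2 + 2) = 2304 := by
    rw [show (2:ℝ) + 1 = ((3:ℕ):ℝ) by norm_num, rpow_natCast]; norm_num
  rw [eA] at f1 f2
  have hlp := hlam.eventually_const_lt hlamBar
  have g1 : Tendsto (fun n => u n 0 * r n ^ 4) atTop (𝓝 (1152 / lamBar)) := by
    have := f2.div hlam hlamBar.ne'
    rw [show (2304:ℝ) ^ 2 / (2 * 2304) = 1152 by norm_num] at this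
    refine this.congr' ?_
    filter_upwards [hlp] with n hn
    have hγ := (hsol n).pos_zero
    have hp : 0 < u n 0 ^ (1 / (2:ℝ)) := by positivity
    have e : (u n 0 ^ (1 / (2:ℝ))) ^ 2 = u n 0 := by
      rw [← rpow_natCast, ← rpow_mul hγ.le]; norm_num
    simp only [Pi.div_apply]
    generalize u n 0 ^ (1 / (2:ℝ)) = μ at *
    rw [← e]
    field_simp
  refine ⟨g1, ?_⟩
  have := (f1.neg).div g1 (by positivity)
  rw [show -2304 / (1152 / lamBar) = -2 * lamBar by field_simp; norm_num] at this
  refine this.congr (fun n => ?_)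
  have hγ := (hsol n).pos_zero
  have hr := (hfz n).1.1
  have hp : 0 < u n 0 ^ (1 / (2:ℝ)) := by positivity
  simp only [Pi.div_apply, E_conv h2 hj hγ]
  rw [show u n 0 ^ (1 / (2:ℝ)) * r n / u n 0 ^ (1 / (2:ℝ)) = r n by field_simp]
  field_simp
  ring

lemma case5 (hlamBar : 0 < lamBar)
    (hlam : Tendsto lam atTop (𝓝 lamBar))
    (hsol : ∀ n, BNSol 5 (lam n) m (u n) (u' n) (u'' n))
    (hfz : ∀ n, IsFirstZero (u n) (r n))
    (hblow : Tendsto (fun n => u n 0) atTop atTop) :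
    Tendsto (fun n => u n 0 * r n ^ ((9:ℝ)/2)) atTop
        (𝓝 ((15:ℝ) ^ ((3:ℝ)/4) * (24 / (π * lamBar)) ^ ((3:ℝ)/2))) ∧
      Tendsto (fun n => u' n (r n) / r n ^ ((1:ℝ)/2)) atTop
        (𝓝 (-((3:ℝ) ^ ((1:ℝ)/4) * (5:ℝ) ^ ((3:ℝ)/4) * (π * lamBar / 8) ^ ((3:ℝ)/2)))) := by
  have h2 : (1:ℝ) ≤ 3 / 2 := by norm_num
  have hj : ((3:ℕ):ℝ) = 2 * (3 / 2) := by norm_num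
  have hπ := Real.pi_pos
  have hs0 : 0 < √(15:ℝ) := by positivity
  have hs2 : √(15:ℝ) ^ 2 = 15 := Real.sq_sqrt (by norm_num)
  obtain ⟨hS, hε, hM⟩ := setup (j := 3) (k := 3 / 2) hj h2 hlamBar hlam hsol hfz hblow
  obtain ⟨f1, f2⟩ := final_big GP5 h2 hj (by norm_num) hS hε hM (by positivity) G5_lim
  have eA : (4 * (3 / 2) * (3 / 2 + 1) : ℝ) ^ ((3 / 2 : ℝ) + 1) / (2 * (3 / 2) + 2) = 45 * √15 := by
    rw [show (4 * (3 / 2) * (3 / 2 + 1) : ℝ) = 15 by norm_num,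
      show (3 / 2 : ℝ) + 1 = (2 : ℕ) + 1 / 2 by norm_num, rpow_add (by norm_num), rpow_natCast,
      ← Real.sqrt_eq_rpow]
    ring
  rw [eA] at f1 f2
  have hlp := hlam.eventually_const_lt hlamBar
  have g0 : Tendsto (fun n => u n 0 ^ (1 / (3 / 2 : ℝ)) * r n ^ 3) atTop
      (𝓝 (√15 * (24 / (π * lamBar)))) := by
    have := f2.div hlam hlamBar.ne'
    rw [show (45 * √15) ^ 2 / (2 * (225 * √15 * (3 * π / 16))) / lamBar = √15 * (24 / (π * lamBar)) by
      field_simp; norm_num] at this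
    refine this.congr' ?_
    filter_upwards [hlp] with n hn
    have hγ := (hsol n).pos_zero
    have hp : 0 < u n 0 ^ (1 / (3 / 2 : ℝ)) := by positivity
    simp only [Pi.div_apply]
    field_simp
  have g1 : Tendsto (fun n => u n 0 * r n ^ ((9:ℝ)/2)) atTop
        (𝓝 ((15:ℝ) ^ ((3:ℝ)/4) * (24 / (π * lamBar)) ^ ((3:ℝ)/2))) := by
    have := g0.rpow_const (p := 3 / 2) (Or.inr (by norm_num))
    rw [mul_rpow (by positivity) (by positivity), Real.sqrt_eq_rpow, ← rpow_mul (by norm_num),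
      show (1 / 2 * (3 / 2) : ℝ) = 3 / 4 by norm_num] at this
    refine this.congr (fun n => ?_)
    have hγ := (hsol n).pos_zero
    have hr := (hfz n).1.1
    rw [mul_rpow (by positivity) (by positivity), ← rpow_mul hγ.le, ← rpow_natCast (r n),
      ← rpow_mul hr.le]
    norm_num
  refine ⟨g1, ?_⟩
  have := (f1.neg).div g1 (by positivity)
  have eL : -(45 * √15) / ((15:ℝ) ^ ((3:ℝ)/4) * (24 / (π * lamBar)) ^ ((3:ℝ)/2)) =
      -((3:ℝ) ^ ((1:ℝ)/4) * (5:ℝ) ^ ((3:ℝ)/4) * (π * lamBar / 8) ^ ((3:ℝ)/2)) := by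
    rw [neg_div, neg_inj, div_eq_iff (by positivity)]
    have e1 : (π * lamBar / 8) ^ ((3:ℝ)/2) * (24 / (π * lamBar)) ^ ((3:ℝ)/2) = 3 ^ ((3:ℝ)/2) := by
      rw [← mul_rpow (by positivity) (by positivity)]
      congr 1
      field_simp
      norm_num
    have e2 : (15:ℝ) ^ ((3:ℝ)/4) = 3 ^ ((3:ℝ)/4) * 5 ^ ((3:ℝ)/4) := by
      rw [← mul_rpow (by norm_num) (by norm_num)]; norm_num
    have e3 : √(15:ℝ) = 3 ^ ((1:ℝ)/2) * 5 ^ ((1:ℝ)/2) := by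
      rw [← mul_rpow (by norm_num) (by norm_num), Real.sqrt_eq_rpow]; norm_num
    have e4 : (3:ℝ) ^ ((1:ℝ)/4) * 3 ^ ((3:ℝ)/4) = 3 := by
      rw [← rpow_add (by norm_num)]; norm_num
    have e5 : (5:ℝ) ^ ((3:ℝ)/4) * 5 ^ ((3:ℝ)/4) = 5 * 5 ^ ((1:ℝ)/2) := by
      rw [← rpow_add (by norm_num), ← rpow_one_add' (by norm_num) (by norm_num)]; norm_num
    have e6 : (3:ℝ) ^ ((3:ℝ)/2) = 3 * 3 ^ ((1:ℝ)/2) := by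
      rw [← rpow_one_add' (by norm_num) (by norm_num)]; norm_num
    calc 45 * √15 = 3 * (5 * 5 ^ ((1:ℝ)/2)) * (3 * 3 ^ ((1:ℝ)/2)) := by rw [e3]; ring
      _ = ((3:ℝ) ^ ((1:ℝ)/4) * 3 ^ ((3:ℝ)/4)) * ((5:ℝ) ^ ((3:ℝ)/4) * 5 ^ ((3:ℝ)/4)) *
          ((π * lamBar / 8) ^ ((3:ℝ)/2) * (24 / (π * lamBar)) ^ ((3:ℝ)/2)) := by
        rw [e4, e5, e1, e6]
      _ = _ := by rw [e2]; ring
  rw [eL] at this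
  refine this.congr (fun n => ?_)
  have hγ := (hsol n).pos_zero
  have hr := (hfz n).1.1
  have hp : 0 < u n 0 ^ (1 / (3 / 2 : ℝ)) := by positivity
  simp only [Pi.div_apply, E_conv h2 hj hγ]
  rw [show u n 0 ^ (1 / (3 / 2 : ℝ)) * r n / u n 0 ^ (1 / (3 / 2 : ℝ)) = r n by field_simp]
  have e : r n ^ ((9:ℝ)/2) = r n ^ 4 * r n ^ ((1:ℝ)/2) := by
    rw [← rpow_natCast, ← rpow_add hr]; norm_num
  rw [e]
  have : 0 < r n ^ ((1:ℝ)/2) := by positivity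
  field_simp
  ring
end
end BN

theorem statement3 (N : ℕ) (hN : N = 4 ∨ N = 5 ∨ N = 6) (m : ℕ) (hm : 1 ≤ m)
    (lamBar : ℝ) (hlamBar : 0 < lamBar)
    (lam : ℕ → ℝ) (hlam : Tendsto lam atTop (𝓝 lamBar))
    (u u' u'' : ℕ → ℝ → ℝ) (r : ℕ → ℝ)
    (hsol : ∀ n, BNSol N (lam n) m (u n) (u' n) (u'' n))
    (hfz : ∀ n, IsFirstZero (u n) (r n))
    (hblow : Tendsto (fun n => u n 0) atTop atTop) :
    (N = 4 →
      Tendsto (fun n => r n ^ 2 * Real.log (u n 0)) atTop (𝓝 (2 / lamBar)) ∧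
      Tendsto (fun n => u' n (r n) * u n 0 * r n ^ 3) atTop (𝓝 (-16))) ∧
    (N = 5 →
      Tendsto (fun n => u n 0 * r n ^ ((9:ℝ)/2)) atTop
        (𝓝 ((15:ℝ) ^ ((3:ℝ)/4) * (24 / (π * lamBar)) ^ ((3:ℝ)/2))) ∧
      Tendsto (fun n => u' n (r n) / r n ^ ((1:ℝ)/2)) atTop
        (𝓝 (-((3:ℝ) ^ ((1:ℝ)/4) * (5:ℝ) ^ ((3:ℝ)/4) * (π * lamBar / 8) ^ ((3:ℝ)/2))))) ∧
    (N = 6 →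
      Tendsto (fun n => u n 0 * r n ^ 4) atTop (𝓝 (1152 / lamBar)) ∧
      Tendsto (fun n => u' n (r n) * r n) atTop (𝓝 (-2 * lamBar))) := by
  refine ⟨fun h => ?_, fun h => ?_, fun h => ?_⟩
  · subst h
    exact BN.case4 hlamBar hlam hsol hfz hblow
  · subst h
    exact BN.case5 hlamBar hlam hsol hfz hblow
  · subst h
    exact BN.case6 hlamBar hlam hsol hfz hblow
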